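/- For every n ≥ 1, every valuation v ∈ F_{C_n}, and every formula α: v(α^n ∧ ¬(α^n)) = F_n. (This is the semantic counterpart of the explosive part of the hierarchy: a contradiction of depth k ≥ n entails every formula in C_n, since c_n(α) = α^n ∧ ¬α^n can never take a designated value under a restricted valuation.) -/

import Mathlib

/-- Formulas of the language of da Costa's calculi `Cₙ`. -/
inductive CnForm : Type where
  | atom : ℕ → CnForm
  | neg : CnForm → CnForm
  | conj : CnForm → CnForm → CnForm
  | disj : CnForm → CnForm → CnForm
  | imp : CnForm → CnForm → CnForm
deriving DecidableEq

/-- Truth values of the Nmatrix `M_{Cₙ}`: `Tv` is `Tₙ`, `tv i` is `tᵢⁿ`, `Fv` is `Fₙ`. -/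
inductive CnVal (n : ℕ) : Type where
  | Tv : CnVal n
  | tv : Fin n → CnVal n
  | Fv : CnVal n
deriving DecidableEq

/-- Multifunction for negation. -/
def CnNeg {n : ℕ} : CnVal n → Set (CnVal n)
  | CnVal.Tv => {CnVal.Fv}
  | CnVal.tv _ => {x | x ≠ CnVal.Fv}
  | CnVal.Fv => {CnVal.Tv}

/-- Multifunction for conjunction. -/
def CnConj {n : ℕ} (x y : CnVal n) : Set (CnVal n) :=
  if x = CnVal.Fv ∨ y = CnVal.Fv then {CnVal.Fv}
  else if x = CnVal.Tv ∧ y = CnVal.Tv then {CnVal.Tv}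
  else {z | z ≠ CnVal.Fv}

/-- Multifunction for disjunction. -/
def CnDisj {n : ℕ} (x y : CnVal n) : Set (CnVal n) :=
  if x = CnVal.Fv ∧ y = CnVal.Fv then {CnVal.Fv}
  else if (x = CnVal.Tv ∨ x = CnVal.Fv) ∧ (y = CnVal.Tv ∨ y = CnVal.Fv) ∧
          (x = CnVal.Tv ∨ y = CnVal.Tv) then {CnVal.Tv}
  else {z | z ≠ CnVal.Fv}

/-- Multifunction for implication. -/
def CnImp {n : ℕ} (x y : CnVal n) : Set (CnVal n) :=
  if x ≠ CnVal.Fv ∧ y = CnVal.Fv then {CnVal.Fv}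
  else if (x = CnVal.Fv ∧ (y = CnVal.Tv ∨ y = CnVal.Fv)) ∨ (x = CnVal.Tv ∧ y = CnVal.Tv)
    then {CnVal.Tv}
  else {z | z ≠ CnVal.Fv}

/-- `v ∈ Val(M_{Cₙ})`: `v` is a valuation of the Nmatrix `M_{Cₙ}`. -/
def CnIsVal {n : ℕ} (v : CnForm → CnVal n) : Prop :=
  (∀ a, v (CnForm.neg a) ∈ CnNeg (v a)) ∧
  (∀ a b, v (CnForm.conj a b) ∈ CnConj (v a) (v b)) ∧
  (∀ a b, v (CnForm.disj a b) ∈ CnDisj (v a) (v b)) ∧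
  (∀ a b, v (CnForm.imp a b) ∈ CnImp (v a) (v b))

/-- `a.pow k` is `αᵏ`: `α⁰ = α`, `α^{k+1} = ¬(αᵏ ∧ ¬αᵏ)`. -/
def CnForm.pow (a : CnForm) : ℕ → CnForm
  | 0 => a
  | k + 1 => CnForm.neg (CnForm.conj (a.pow k) (CnForm.neg (a.pow k)))

/-- `v ∈ F_{Cₙ}`: a valuation satisfying the restriction of the RNmatrix for `Cₙ`. -/
def CnRestricted {n : ℕ} (v : CnForm → CnVal n) : Prop :=
  CnIsVal v ∧
  ∀ (a : CnForm) (i : Fin n), v a = CnVal.tv i →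
    (i.val = 0 → v (CnForm.conj a (CnForm.neg a)) = CnVal.Tv) ∧
    (∀ j : Fin n, i.val = j.val + 1 →
      (∃ m : Fin n, v (CnForm.conj a (CnForm.neg a)) = CnVal.tv m) ∧
      v (a.pow 1) = CnVal.tv j)

/-- Tautology of the RNmatrix `R(M_{Cₙ}) = ⟨F_{Cₙ}, M_{Cₙ}⟩`. -/
def CnTaut (n : ℕ) (φ : CnForm) : Prop :=
  ∀ v : CnForm → CnVal n, CnRestricted v → v φ ≠ CnVal.Fv

/-- A contradiction formed from a formula without an inconsistent value is false. -/
theorem CnIsVal.conj_neg_eq_Fv {n : ℕ} {v : CnForm → CnVal n} (hv : CnIsVal v) {a : CnForm}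
    (ha : ∀ i, v a ≠ CnVal.tv i) : v (CnForm.conj a (CnForm.neg a)) = CnVal.Fv := by
  have hneg := hv.1 a
  have hconj := hv.2.1 a (CnForm.neg a)
  cases h : v a with
  | tv i => exact absurd h (ha i)
  | Tv => simp_all [CnNeg, CnConj]
  | Fv => simp_all [CnConj]

/-- An inconsistent value of `a.pow 1` is one step below the value of `a`. -/
theorem CnRestricted.exists_of_pow_one_eq_tv {n : ℕ} {v : CnForm → CnVal n}
    (hv : CnRestricted v) {a : CnForm} {j : Fin n} (h : v (a.pow 1) = CnVal.tv j) :
    ∃ i : Fin n, v a = CnVal.tv i ∧ i.val = j.val + 1 := by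
  have hneg : v (a.pow 1) ∈ CnNeg (v (CnForm.conj a (CnForm.neg a))) := hv.1.1 _
  by_cases ha : ∀ i, v a ≠ CnVal.tv i
  · simp [hv.1.conj_neg_eq_Fv ha, h, CnNeg] at hneg
  · push Not at ha
    obtain ⟨i, hi⟩ := ha
    refine ⟨i, hi, ?_⟩
    obtain ⟨hzero, hsucc⟩ := hv.2 a i hi
    rcases Nat.eq_zero_or_eq_succ_pred i.val with h0 | h0
    · simp [hzero h0, h, CnNeg] at hneg
    · have hpow := (hsucc ⟨i.val.pred, by omega⟩ h0).2
      rw [h, CnVal.tv.injEq] at hpow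
      rw [hpow]
      exact h0

/-- An inconsistent value of `a.pow k` is `tᵢ` with `i + k < n`. -/
theorem CnRestricted.add_lt_of_pow_eq_tv {n : ℕ} {v : CnForm → CnVal n}
    (hv : CnRestricted v) (a : CnForm) (k : ℕ) (i : Fin n)
    (h : v (a.pow k) = CnVal.tv i) : i.val + k < n := by
  induction k generalizing i with
  | zero => exact i.isLt
  | succ k ih =>
    obtain ⟨j, hj, hij⟩ := hv.exists_of_pow_one_eq_tv (a := a.pow k) h
    have := ih j hj
    omega

theorem depth_n_contradiction_is_false (n : ℕ) (hn : 1 ≤ n)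
    (v : CnForm → CnVal n) (hv : CnRestricted v) (a : CnForm) :
    v (CnForm.conj (a.pow n) (CnForm.neg (a.pow n))) = CnVal.Fv := by
  refine hv.1.conj_neg_eq_Fv fun i hi => ?_
  have := hv.add_lt_of_pow_eq_tv a n i hi
  omega
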